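/- arXiv:1009.5360 — 2 statements merged into one kernel-verified Lean document; each statement's English description precedes it below -/
import Mathlib

section
/- For every integer h ≥ 2 there are infinitely many positive integers n such that s_F(n^h)/s_F(n) < 120h²/log n; i.e., the lower bound c₄/log n for s_F(n^h)/s_F(n) is attained in order of magnitude with constant c₄' = 120h². -/
/-- Zeckendorf sum of digits: number of summands in the Zeckendorf
representation of `n` (equivalently, minimal number of Fibonacci numbers
needed to write `n` as a sum of Fibonacci numbers). -/
def sF (n : ℕ) : ℕ := (Nat.zeckendorf n).length

/-- Lucas numbers: `L 0 = 2`, `L k = F (k-1) + F (k+1)` for `k ≥ 1`. -/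
def lucas : ℕ → ℕ
  | 0 => 2
  | k + 1 => Nat.fib k + Nat.fib (k + 2)

open Real Polynomial goldenRatio

theorem sF_zero : sF 0 = 0 := by simp [sF]

theorem sF_fib_add {m r : ℕ} (hr : r < Nat.fib m) :
    sF (Nat.fib (m + 1) + r) = sF r + 1 := by
  have hm : 0 < m := by
    rcases Nat.eq_zero_or_pos m with rfl | h
    · simp at hr
    · exact h
  have hpos : 0 < Nat.fib (m + 1) := Nat.fib_pos.2 (by omega)
  have hg : Nat.greatestFib (Nat.fib (m + 1) + r) = m + 1 := by
    apply le_antisymm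
    · apply Nat.lt_succ_iff.1
      rw [Nat.greatestFib_lt]
      have : Nat.fib (m + 1 + 1) = Nat.fib m + Nat.fib (m + 1) := Nat.fib_add_two
      rw [Nat.succ_eq_add_one]
      omega
    · rw [Nat.le_greatestFib]
      omega
  rw [sF, Nat.zeckendorf_of_pos (by omega), hg, Nat.add_sub_cancel_left, List.length_cons, sF]

/-- Adding one Fibonacci number raises the Zeckendorf sum of digits by at most one. -/
theorem sF_add_fib_le (n k : ℕ) : sF (n + Nat.fib k) ≤ sF n + 1 := by
  induction n using Nat.strong_induction_on generalizing k with
  | _ n ih =>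
  wlog hk : 2 ≤ k generalizing k
  · obtain rfl | rfl : k = 0 ∨ k = 1 := by omega
    · simp
    · simpa using this 2 le_rfl
  obtain ⟨k, rfl⟩ := Nat.exists_eq_add_of_le' hk
  rcases Nat.eq_zero_or_pos n with rfl | hn
  · have := sF_fib_add (m := k + 1) (r := 0) (Nat.fib_pos.2 (by omega))
    simp only [Nat.add_zero] at this
    rw [zero_add, this]
  have hg : 2 ≤ Nat.greatestFib n := by
    rw [Nat.le_greatestFib]
    simpa using Nat.one_le_iff_ne_zero.2 hn.ne'
  obtain ⟨m, hm⟩ := Nat.exists_eq_add_of_le' hg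
  have h1 := Nat.fib_greatestFib_le n
  have h2 := Nat.lt_fib_greatestFib_add_one n
  rw [hm] at h1 h2
  obtain ⟨r, rfl⟩ := Nat.exists_eq_add_of_le h1
  have f2 : Nat.fib (m + 2) = Nat.fib m + Nat.fib (m + 1) := Nat.fib_add_two
  have f3 : Nat.fib (m + 2 + 1) = Nat.fib (m + 1) + Nat.fib (m + 2) := Nat.fib_add_two
  have p1 : 0 < Nat.fib (m + 1) := Nat.fib_pos.2 (by omega)
  have hr : r < Nat.fib (m + 1) := by omega
  have hs : sF (Nat.fib (m + 2) + r) = sF r + 1 := sF_fib_add hr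
  have hrn : r < Nat.fib (m + 2) + r := by omega
  rcases lt_trichotomy k m with hkm | rfl | hkm
  · have hq := ih r hrn (k + 2)
    rcases Nat.lt_or_ge (k + 1) m with hkm' | hkm'
    · have hle : Nat.fib (k + 2) ≤ Nat.fib m := Nat.fib_mono (by omega)
      rw [hs, add_assoc]
      rcases Nat.lt_or_ge (r + Nat.fib (k + 2)) (Nat.fib (m + 1)) with hlt | hge
      · rw [sF_fib_add hlt]
        omega
      · obtain ⟨r', hr'⟩ := Nat.exists_eq_add_of_le hge
        have hr'm : r' < Nat.fib m := by omega
        have e : Nat.fib (m + 2) + (r + Nat.fib (k + 2)) = Nat.fib (m + 2 + 1) + r' := by omega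
        rw [e, sF_fib_add (by omega)]
        rw [hr', sF_fib_add hr'm] at hq
        omega
    · obtain rfl : m = k + 1 := by omega
      have hlt : r < Nat.fib (k + 1 + 2) := hr.trans_le (Nat.fib_mono (by omega))
      have e : Nat.fib (k + 1 + 2) + r + Nat.fib (k + 2) = Nat.fib (k + 1 + 2 + 1) + r := by
        have : Nat.fib (k + 1 + 2 + 1) = Nat.fib (k + 2) + Nat.fib (k + 1 + 2) := Nat.fib_add_two
        omega
      rw [e, sF_fib_add hlt, hs]
      omega
  · have e : Nat.fib (k + 2) + r + Nat.fib (k + 2)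
        = Nat.fib (k + 2 + 1) + (r + Nat.fib k) := by omega
    have hq := ih r hrn k
    rw [e, sF_fib_add (by omega), hs]
    omega
  · rcases Nat.lt_or_ge (m + 1) k with hkm' | hkm'
    · have hle : Nat.fib (m + 2 + 1) ≤ Nat.fib (k + 1) := Nat.fib_mono (by omega)
      rw [add_comm _ (Nat.fib (k + 2)), sF_fib_add (by omega)]
    · obtain rfl : k = m + 1 := by omega
      have hlt : r < Nat.fib (m + 3) := hr.trans_le (Nat.fib_mono (by omega))
      have e : Nat.fib (m + 2) + r + Nat.fib (m + 1 + 2) = Nat.fib (m + 3 + 1) + r := by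
        have : Nat.fib (m + 3 + 1) = Nat.fib (m + 2) + Nat.fib (m + 1 + 2) := Nat.fib_add_two
        omega
      rw [e, sF_fib_add hlt, hs]
      omega

/-- `x` is a sum of at most `c` (not necessarily distinct) even integer powers of `φ`. -/
def IsPhiSum (c : ℕ) (x : ℝ) : Prop :=
  ∃ M : Multiset ℤ, M.card ≤ c ∧ (M.map fun a : ℤ => φ ^ (2 * a)).sum = x

namespace IsPhiSum

theorem zero (c : ℕ) : IsPhiSum c 0 := ⟨0, by simp, by simp⟩

theorem zpow (a : ℤ) : IsPhiSum 1 (φ ^ (2 * a)) := ⟨{a}, by simp, by simp⟩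

theorem mono {c c' : ℕ} {x : ℝ} (h : IsPhiSum c x) (hc : c ≤ c') : IsPhiSum c' x := by
  obtain ⟨M, hM, hx⟩ := h
  exact ⟨M, hM.trans hc, hx⟩

theorem add {c c' : ℕ} {x y : ℝ} (hx : IsPhiSum c x) (hy : IsPhiSum c' y) :
    IsPhiSum (c + c') (x + y) := by
  obtain ⟨M, hM, rfl⟩ := hx
  obtain ⟨M', hM', rfl⟩ := hy
  exact ⟨M + M', by simpa using Nat.add_le_add hM hM', by simp⟩

theorem mul_zpow {c : ℕ} {x : ℝ} (hx : IsPhiSum c x) (b : ℤ) :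
    IsPhiSum c (x * φ ^ (2 * b)) := by
  obtain ⟨M, hM, rfl⟩ := hx
  refine ⟨M.map (· + b), by simpa using hM, ?_⟩
  rw [Multiset.map_map, ← Multiset.sum_map_mul_right]
  congr 1
  refine Multiset.map_congr rfl fun a _ => ?_
  rw [Function.comp_apply, mul_add, zpow_add₀ goldenRatio_ne_zero]

theorem sum {ι : Type*} (s : Finset ι) {c : ℕ} {f : ι → ℝ} (hf : ∀ i ∈ s, IsPhiSum c (f i)) :
    IsPhiSum (s.card * c) (∑ i ∈ s, f i) := by
  classical
  induction s using Finset.induction_on with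
  | empty => simpa using zero 0
  | insert a s ha ih =>
    rw [Finset.sum_insert ha, Finset.card_insert_of_notMem ha]
    refine ((hf a (Finset.mem_insert_self a s)).add
      (ih fun i hi => hf i (Finset.mem_insert_of_mem hi))).mono (le_of_eq (by ring))

end IsPhiSum

theorem goldenConj_pow_two_mul (b : ℕ) : ψ ^ (2 * b) = φ ^ (2 * (-(b : ℤ))) := by
  have h : ψ = -φ⁻¹ := by rw [inv_goldenRatio, neg_neg]
  rw [mul_neg, zpow_neg, ← inv_zpow, h, Even.neg_pow ⟨b, by ring⟩]
  norm_cast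

theorem exists_goldenRatio_zpow_eq (a : ℤ) :
    ∃ (u : ℤ) (m : ℕ), φ ^ (2 * a) = u * φ + Nat.fib m := by
  rcases le_or_gt a 0 with ha | ha
  · obtain ⟨b, hb⟩ := Int.eq_ofNat_of_zero_le (neg_nonneg.2 ha)
    obtain rfl : a = -(b : ℤ) := by omega
    refine ⟨-(Nat.fib (2 * b) : ℤ), 2 * b + 1, ?_⟩
    rw [← goldenConj_pow_two_mul, ← fib_succ_sub_goldenRatio_mul_fib]
    push_cast
    ring
  · obtain ⟨b, rfl⟩ : ∃ b : ℕ, a = b + 1 := ⟨(a - 1).toNat, by omega⟩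
    refine ⟨Nat.fib (2 * b + 2), 2 * b + 1, ?_⟩
    have h := goldenRatio_mul_fib_succ_add_fib (2 * b + 1)
    have e : φ ^ (2 * ((b : ℤ) + 1)) = φ ^ (2 * b + 1 + 1) := by
      rw [← zpow_natCast]
      congr 1
    rw [e, ← h]
    push_cast
    ring

theorem IsPhiSum.sF_le {c n : ℕ} (hn : IsPhiSum c n) : sF n ≤ c := by
  obtain ⟨M, hM, hsum⟩ := hn
  have key : ∀ M : Multiset ℤ, ∃ (u : ℤ) (v : ℕ), sF v ≤ M.card ∧
      (M.map fun a : ℤ => φ ^ (2 * a)).sum = u * φ + v := by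
    intro M
    induction M using Multiset.induction_on with
    | empty => exact ⟨0, 0, by simp [sF_zero], by simp⟩
    | cons a M ih =>
      obtain ⟨u, v, hv, hs⟩ := ih
      obtain ⟨u', m, hm⟩ := exists_goldenRatio_zpow_eq a
      refine ⟨u + u', v + Nat.fib m, ?_, ?_⟩
      · rw [Multiset.card_cons]
        exact (sF_add_fib_le v m).trans (by omega)
      · rw [Multiset.map_cons, Multiset.sum_cons, hs, hm]
        push_cast
        ring
  obtain ⟨u, v, hv, hs⟩ := key M
  rw [hsum] at hs
  have hu : u = 0 := by
    by_contra hu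
    refine ((goldenRatio_irrational.intCast_mul hu).add_natCast v).ne_nat n hs.symm
  subst hu
  have : n = v := by exact_mod_cast (by simpa using hs : (n : ℝ) = v)
  exact this ▸ hv.trans hM

theorem lucas_add_two (k : ℕ) : lucas (k + 2) = lucas k + lucas (k + 1) := by
  cases k with
  | zero => decide
  | succ k =>
    simp only [lucas]
    have h1 := Nat.fib_add_two (n := k)
    have h2 := Nat.fib_add_two (n := k + 2)
    have h3 := Nat.fib_add_two (n := k + 1)
    simp only [add_assoc, Nat.reduceAdd] at *
    omega

theorem coe_lucas (k : ℕ) : (lucas k : ℝ) = φ ^ k + ψ ^ k := by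
  induction k using Nat.twoStepInduction with
  | zero => norm_num [lucas]
  | one => simp [lucas, goldenRatio_add_goldenConj]
  | more k h1 h2 =>
    rw [lucas_add_two, Nat.cast_add, h1, h2, pow_add φ k 2, pow_add ψ k 2, goldenRatio_sq,
      goldenConj_sq]
    ring

theorem isPhiSum_lucas (j : ℕ) : IsPhiSum 2 (lucas (2 * j)) := by
  rw [coe_lucas, goldenConj_pow_two_mul]
  have e : φ ^ (2 * j) = φ ^ (2 * (j : ℤ)) := by norm_cast
  rw [e]
  exact (IsPhiSum.zpow _).add (IsPhiSum.zpow _)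

theorem isPhiSum_natCast_aux (J : ℕ) :
    (∀ d : ℕ, d < lucas (2 * J + 2) → IsPhiSum (2 * (J + 2)) d) ∧
    (∀ d : ℕ, d + lucas (2 * J) < lucas (2 * J + 2) → IsPhiSum (2 * (J + 1)) d) := by
  induction J with
  | zero =>
    have one : IsPhiSum 1 1 := by simpa using IsPhiSum.zpow 0
    have l0 : lucas (2 * 0) = 2 := rfl
    have l2 : lucas (2 * 0 + 2) = 3 := rfl
    constructor
    · intro d hd
      rw [l2] at hd
      interval_cases d
      · simpa using IsPhiSum.zero 4
      · simpa using one.mono (c' := 4) (by norm_num)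
      · have := (one.add one).mono (c' := 4) (by norm_num)
        norm_num at this ⊢
        exact this
    · intro d hd
      obtain rfl : d = 0 := by omega
      simpa using IsPhiSum.zero 2
  | succ J ih =>
    obtain ⟨G, H⟩ := ih
    have r2 := lucas_add_two (2 * J)
    have r3 := lucas_add_two (2 * J + 1)
    have r4 := lucas_add_two (2 * J + 2)
    have r5 : 2 * (J + 1) = 2 * J + 2 := by ring
    rw [r5]
    simp only [add_assoc, Nat.reduceAdd] at *
    have of_sub : ∀ d c : ℕ, lucas (2 * J + 2) ≤ d →
        IsPhiSum c ((d - lucas (2 * J + 2) : ℕ) : ℝ) → IsPhiSum (2 + c) d := by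
      intro d c hd hc
      have := (isPhiSum_lucas (J + 1)).add hc
      rwa [r5, ← Nat.cast_add, Nat.add_sub_cancel' hd] at this
    constructor
    · intro d hd
      rcases Nat.lt_or_ge d (lucas (2 * J + 2)) with h1 | h1
      · exact (G d h1).mono (by omega)
      rcases Nat.lt_or_ge (d - lucas (2 * J + 2)) (lucas (2 * J + 2)) with h2 | h2
      · exact (of_sub d _ h1 (G _ h2)).mono (by omega)
      · exact (of_sub d _ h1 (of_sub _ _ h2 (H _ (by omega)))).mono (by omega)
    · intro d hd
      rcases Nat.lt_or_ge d (lucas (2 * J + 2)) with h1 | h1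
      · exact (G d h1).mono (by omega)
      · exact (of_sub d _ h1 (H _ (by omega))).mono (by omega)

theorem isPhiSum_natCast {J d : ℕ} (hJ : 1 ≤ J) (hd : d < lucas (2 * J)) :
    IsPhiSum (2 * (J + 1)) d := by
  obtain ⟨J, rfl⟩ := Nat.exists_eq_add_of_le' hJ
  exact (isPhiSum_natCast_aux J).1 d hd

theorem eleven_lt_goldenRatio_pow_five : 11 < φ ^ 5 := by
  have h5 : φ ^ 5 = 5 * φ + 3 := by
    linear_combination (φ ^ 3 + φ ^ 2 + 2 * φ + 3) * goldenRatio_sq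
  have : (2.2 : ℝ) < √5 := Real.lt_sqrt_of_sq_lt (by norm_num)
  rw [h5, goldenRatio]
  linarith

theorem eleven_pow_lt_lucas {h : ℕ} (hh : 1 ≤ h) : 11 ^ h < lucas (2 * ((5 * h + 1) / 2)) := by
  have key : (11 : ℝ) ^ h < (lucas (2 * ((5 * h + 1) / 2)) : ℝ) := by
    rw [coe_lucas]
    calc (11 : ℝ) ^ h < (φ ^ 5) ^ h :=
          pow_lt_pow_left₀ eleven_lt_goldenRatio_pow_five (by norm_num) (by omega)
      _ = φ ^ (5 * h) := (pow_mul _ _ _).symm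
      _ ≤ φ ^ (2 * ((5 * h + 1) / 2)) :=
          pow_le_pow_right₀ one_lt_goldenRatio.le (by omega)
      _ ≤ _ := le_add_of_nonneg_right (Even.pow_nonneg ⟨(5 * h + 1) / 2, by ring⟩ _)
  exact_mod_cast key

/-- A polynomial with a negative coefficient all of whose higher powers have nonnegative
coefficients. -/
noncomputable def stolarskyPoly : ℤ[X] := 3 * X ^ 4 + 3 * X ^ 3 - X ^ 2 + 3 * X + 3

theorem exists_map_eq_stolarskyPoly_pow {h : ℕ} (hh : 2 ≤ h) :
    ∃ p : ℕ[X], p.map (Nat.castRingHom ℤ) = stolarskyPoly ^ h := by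
  induction h using Nat.strong_induction_on with
  | _ h ih =>
  have h2 : ∃ p : ℕ[X], p.map (Nat.castRingHom ℤ) = stolarskyPoly ^ 2 := by
    refine ⟨9 * X ^ 8 + 18 * X ^ 7 + 3 * X ^ 6 + 12 * X ^ 5 + 37 * X ^ 4 +
       12 * X ^ 3 + 3 * X ^ 2 + 18 * X ^ 1 + 9 * X ^ 0, ?_⟩
    simp only [stolarskyPoly, Polynomial.map_add, Polynomial.map_mul, Polynomial.map_pow, map_X,
      Polynomial.map_ofNat]
    ring
  rcases Nat.lt_or_ge h 4 with h4 | h4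
  · obtain rfl | rfl : h = 2 ∨ h = 3 := by omega
    · exact h2
    · refine ⟨27 * X ^ 12 + 81 * X ^ 11 + 54 * X ^ 10 + 54 * X ^ 9 + 225 * X ^ 8 + 198 * X ^ 7 + 53 * X ^ 6 +
       198 * X ^ 5 + 225 * X ^ 4 + 54 * X ^ 3 + 54 * X ^ 2 + 81 * X ^ 1 + 27 * X ^ 0, ?_⟩
      simp only [stolarskyPoly, Polynomial.map_add, Polynomial.map_mul, Polynomial.map_pow, map_X,
        Polynomial.map_ofNat]
      ring
  · obtain ⟨p, hp⟩ := h2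
    obtain ⟨q, hq⟩ := ih (h - 2) (by omega) (by omega)
    refine ⟨p * q, ?_⟩
    rw [Polynomial.map_mul, hp, hq, ← pow_add]
    congr 1
    omega

theorem natDegree_stolarskyPoly_le : stolarskyPoly.natDegree ≤ 4 := by
  unfold stolarskyPoly
  compute_degree

/-- The powers of the values of `stolarskyPoly`, with coefficients and degree controlled. -/
theorem exists_stolarskyPoly_pow_eq_sum {h : ℕ} (hh : 2 ≤ h) :
    ∃ c : ℕ → ℕ, (∀ i, c i ≤ 11 ^ h) ∧ ∀ x : ℝ,
      (3 * x ^ 4 + 3 * x ^ 3 - x ^ 2 + 3 * x + 3) ^ h =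
        ∑ i ∈ Finset.range (4 * h + 1), (c i : ℝ) * x ^ i := by
  obtain ⟨p, hp⟩ := exists_map_eq_stolarskyPoly_pow hh
  have hdeg : p.natDegree < 4 * h + 1 := by
    have h1 : (p.map (Nat.castRingHom ℤ)).natDegree = p.natDegree :=
      natDegree_map_eq_of_injective Nat.cast_injective p
    rw [← h1, hp, Nat.lt_succ_iff, mul_comm]
    exact natDegree_pow_le_of_le h natDegree_stolarskyPoly_le
  have hx : ∀ x : ℝ, (3 * x ^ 4 + 3 * x ^ 3 - x ^ 2 + 3 * x + 3) ^ h =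
      ∑ i ∈ Finset.range (4 * h + 1), (p.coeff i : ℝ) * x ^ i := by
    intro x
    have h1 : (p.map (Nat.castRingHom ℤ)).eval₂ (Int.castRingHom ℝ) x =
        (3 * x ^ 4 + 3 * x ^ 3 - x ^ 2 + 3 * x + 3) ^ h := by
      rw [hp, eval₂_pow]
      simp [stolarskyPoly, eval₂_add, eval₂_sub, eval₂_mul, eval₂_pow]
    rw [← h1, eval₂_map, eval₂_eq_sum_range' _ hdeg]
    simp
  refine ⟨p.coeff, fun i => ?_, hx⟩
  have h1 := hx 1
  norm_num at h1
  have h2 : 11 ^ h = ∑ i ∈ Finset.range (4 * h + 1), p.coeff i := by exact_mod_cast h1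
  rcases Nat.lt_or_ge i (4 * h + 1) with hi | hi
  · rw [h2]
    exact Finset.single_le_sum (f := p.coeff) (fun _ _ => Nat.zero_le _) (Finset.mem_range.2 hi)
  · rw [coeff_eq_zero_of_natDegree_lt (by omega)]
    exact Nat.zero_le _

/-- The value of `stolarskyPoly` at `x = φ ^ (2 * j + 4)`, divided by `x ^ 2`. -/
def stolarskyNum (j : ℕ) : ℕ :=
  Nat.fib (4 * j + 11) + (Nat.fib (4 * j + 9) + (Nat.fib (4 * j + 7) + (Nat.fib (4 * j + 5) +
    (Nat.fib (2 * j + 7) + (Nat.fib (2 * j + 5) + (Nat.fib (2 * j + 3) +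
      (Nat.fib (2 * j + 1) - 1)))))))

theorem lt_fib_and_sF_fib_add {m k r c : ℕ} (h : r < Nat.fib m ∧ sF r = c) (hmk : m ≤ k) :
    Nat.fib (k + 1) + r < Nat.fib (k + 2) ∧ sF (Nat.fib (k + 1) + r) = c + 1 := by
  have h1 : r < Nat.fib k := h.1.trans_le (Nat.fib_mono hmk)
  refine ⟨?_, by rw [sF_fib_add h1, h.2]⟩
  rw [Nat.fib_add_two]
  omega

theorem sF_fib_sub_one (j : ℕ) :
    Nat.fib (2 * j + 1) - 1 < Nat.fib (2 * j + 1) ∧ sF (Nat.fib (2 * j + 1) - 1) = j := by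
  induction j with
  | zero => simp [sF_zero]
  | succ j ih =>
    have h := lt_fib_and_sF_fib_add ih le_rfl
    have e : Nat.fib (2 * (j + 1) + 1) - 1 =
        Nat.fib (2 * j + 1 + 1) + (Nat.fib (2 * j + 1) - 1) := by
      have : Nat.fib (2 * (j + 1) + 1) = Nat.fib (2 * j + 1) + Nat.fib (2 * j + 1 + 1) :=
        Nat.fib_add_two
      have : 0 < Nat.fib (2 * j + 1) := Nat.fib_pos.2 (by omega)
      omega
    rw [e]
    exact h

theorem stolarskyNum_lt_and_sF {j : ℕ} (hj : 2 ≤ j) :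
    stolarskyNum j < Nat.fib (4 * j + 12) ∧ sF (stolarskyNum j) = j + 7 := by
  have h1 := lt_fib_and_sF_fib_add (sF_fib_sub_one j) (k := 2 * j + 2) (by omega)
  have h2 := lt_fib_and_sF_fib_add h1 (k := 2 * j + 4) (by omega)
  have h3 := lt_fib_and_sF_fib_add h2 (k := 2 * j + 6) (by omega)
  have h4 := lt_fib_and_sF_fib_add h3 (k := 4 * j + 4) (by omega)
  have h5 := lt_fib_and_sF_fib_add h4 (k := 4 * j + 6) (by omega)
  have h6 := lt_fib_and_sF_fib_add h5 (k := 4 * j + 8) (by omega)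
  exact lt_fib_and_sF_fib_add h6 (k := 4 * j + 10) (by omega)

theorem lt_stolarskyNum (j : ℕ) : j < stolarskyNum j := by
  have := Nat.le_fib_add_one (4 * j + 11)
  unfold stolarskyNum
  omega

theorem fib_add_fib_add_two (m : ℕ) :
    (Nat.fib m : ℝ) + Nat.fib (m + 2) = φ ^ (m + 1) + ψ ^ (m + 1) := by
  rw [← coe_lucas, lucas, Nat.cast_add]

theorem stolarskyNum_mul_sq (j : ℕ) {x : ℝ} (hx : x = φ ^ (2 * j + 4)) :
    (stolarskyNum j : ℝ) * x ^ 2 = 3 * x ^ 4 + 3 * x ^ 3 - x ^ 2 + 3 * x + 3 := by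
  obtain ⟨y, hy⟩ : ∃ y, y = ψ ^ (2 * j + 4) := ⟨_, rfl⟩
  have hxy : x * y = 1 := by
    rw [hx, hy, ← mul_pow, goldenRatio_mul_goldenConj]
    exact Even.neg_one_pow ⟨j + 2, by ring⟩
  have hinv : φ ^ 2 * ψ ^ 2 = 1 := by rw [← mul_pow, goldenRatio_mul_goldenConj]; norm_num
  have hadd : φ ^ 2 + ψ ^ 2 = 3 := by
    rw [goldenRatio_sq, goldenConj_sq]
    linear_combination goldenRatio_add_goldenConj
  have h1 := fib_add_fib_add_two (4 * j + 9)
  have h2 := fib_add_fib_add_two (4 * j + 5)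
  have h3 := fib_add_fib_add_two (2 * j + 5)
  have h4 := fib_add_fib_add_two (2 * j + 1)
  have a1 : φ ^ (4 * j + 9 + 1) = x ^ 2 * φ ^ 2 := by rw [hx]; ring
  have b1 : ψ ^ (4 * j + 9 + 1) = y ^ 2 * ψ ^ 2 := by rw [hy]; ring
  have a2 : φ ^ (4 * j + 5 + 1) = x ^ 2 * ψ ^ 2 := by
    rw [hx]; linear_combination (-φ ^ (4 * j + 6)) * hinv
  have b2 : ψ ^ (4 * j + 5 + 1) = y ^ 2 * φ ^ 2 := by
    rw [hy]; linear_combination (-ψ ^ (4 * j + 6)) * hinv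
  have a3 : φ ^ (2 * j + 5 + 1) = x * φ ^ 2 := by rw [hx]; ring
  have b3 : ψ ^ (2 * j + 5 + 1) = y * ψ ^ 2 := by rw [hy]; ring
  have a4 : φ ^ (2 * j + 1 + 1) = x * ψ ^ 2 := by
    rw [hx]; linear_combination (-φ ^ (2 * j + 2)) * hinv
  have b4 : ψ ^ (2 * j + 1 + 1) = y * φ ^ 2 := by
    rw [hy]; linear_combination (-ψ ^ (2 * j + 2)) * hinv
  rw [a1, b1] at h1
  rw [a2, b2] at h2
  rw [a3, b3] at h3
  rw [a4, b4] at h4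
  have hn : (stolarskyNum j : ℝ) = 3 * (x ^ 2 + y ^ 2) + 3 * (x + y) - 1 := by
    have hp : 1 ≤ Nat.fib (2 * j + 1) := Nat.fib_pos.2 (by omega)
    rw [stolarskyNum]
    push_cast [Nat.cast_sub hp]
    linear_combination h1 + h2 + h3 + h4 + (x ^ 2 + y ^ 2 + x + y) * hadd
  rw [hn]
  linear_combination (3 * (x * y + 1) + 3 * x) * hxy

theorem sF_stolarskyNum_pow_le (j : ℕ) {h : ℕ} (hh : 2 ≤ h) :
    sF (stolarskyNum j ^ h) ≤ (4 * h + 1) * (5 * h + 3) := by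
  apply IsPhiSum.sF_le
  obtain ⟨c, hc, hx⟩ := exists_stolarskyPoly_pow_eq_sum hh
  have hx0 : φ ^ (2 * j + 4) ≠ 0 := pow_ne_zero _ goldenRatio_ne_zero
  have key : ((stolarskyNum j ^ h : ℕ) : ℝ) = ∑ i ∈ Finset.range (4 * h + 1),
      (c i : ℝ) * φ ^ (2 * (((j : ℤ) + 2) * (i - 2 * h))) := by
    have h1 := hx (φ ^ (2 * j + 4))
    rw [← stolarskyNum_mul_sq j rfl, mul_pow] at h1
    rw [Nat.cast_pow, ← mul_left_inj' (pow_ne_zero h (pow_ne_zero 2 hx0)), h1, Finset.sum_mul]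
    refine Finset.sum_congr rfl fun i _ => ?_
    rw [mul_assoc]
    congr 1
    simp only [← zpow_natCast, ← zpow_mul, ← zpow_add₀ goldenRatio_ne_zero]
    congr 1
    push_cast
    ring
  rw [key]
  have := IsPhiSum.sum (Finset.range (4 * h + 1)) (c := 2 * ((5 * h + 1) / 2 + 1))
    (f := fun i => (c i : ℝ) * φ ^ (2 * (((j : ℤ) + 2) * (i - 2 * h)))) fun i _ =>
      (isPhiSum_natCast (by omega) ((hc i).trans_lt (eleven_pow_lt_lucas (by omega)))).mul_zpow _
  refine this.mono ?_
  rw [Finset.card_range]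
  exact Nat.mul_le_mul_left _ (by omega)

theorem fib_le_goldenRatio_pow (m : ℕ) : (Nat.fib m : ℝ) ≤ φ ^ m := by
  have h := fib_succ_sub_goldenConj_mul_fib m
  have h1 : (Nat.fib m : ℝ) ≤ Nat.fib (m + 1) := by exact_mod_cast Nat.fib_le_fib_succ
  have h2 : 0 ≤ -ψ * Nat.fib m := mul_nonneg (neg_nonneg.2 goldenConj_neg.le) (Nat.cast_nonneg _)
  linarith

theorem log_goldenRatio_lt : Real.log φ < 1 / 2 := by
  have h1 : φ ^ 2 < Real.exp 1 := by
    have : √5 < 2.3 := (Real.sqrt_lt' (by norm_num)).2 (by norm_num)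
    have := Real.exp_one_gt_d9
    rw [goldenRatio_sq, goldenRatio]
    linarith
  have h2 := (Real.log_lt_iff_lt_exp (pow_pos goldenRatio_pos 2)).2 h1
  rw [Real.log_pow] at h2
  push_cast at h2
  linarith

theorem log_stolarskyNum_le {j : ℕ} (hj : 2 ≤ j) : Real.log (stolarskyNum j) ≤ 2 * j + 6 := by
  have h0 : 0 < stolarskyNum j := (Nat.zero_le j).trans_lt (lt_stolarskyNum j)
  have h1 : (stolarskyNum j : ℝ) ≤ φ ^ (4 * j + 12) :=
    le_trans (by exact_mod_cast (stolarskyNum_lt_and_sF hj).1.le) (fib_le_goldenRatio_pow _)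
  have h2 := Real.log_le_log (by exact_mod_cast h0) h1
  rw [Real.log_pow] at h2
  refine h2.trans ((mul_le_mul_of_nonneg_left log_goldenRatio_lt.le (Nat.cast_nonneg _)).trans ?_)
  push_cast
  linarith

theorem stmt_2 (h : ℕ) (hh : 2 ≤ h) (N : ℕ) :
    ∃ n : ℕ, N < n ∧ (sF (n ^ h) : ℝ) / (sF n) < 120 * h ^ 2 / Real.log n := by
  refine ⟨stolarskyNum (N + 2), (by omega : N < N + 2).trans (lt_stolarskyNum _), ?_⟩
  have hn : 1 < stolarskyNum (N + 2) := (by omega : 1 < N + 2).trans (lt_stolarskyNum _)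
  have hlog : 0 < Real.log (stolarskyNum (N + 2)) := Real.log_pos (by exact_mod_cast hn)
  have hle := log_stolarskyNum_le (Nat.le_add_left 2 N)
  have hpow : (sF (stolarskyNum (N + 2) ^ h) : ℝ) ≤ (4 * h + 1) * (5 * h + 3) := by
    exact_mod_cast sF_stolarskyNum_pow_le (N + 2) hh
  have h2 : (2 : ℝ) ≤ h := by exact_mod_cast hh
  rw [(stolarskyNum_lt_and_sF (Nat.le_add_left 2 N)).2, div_lt_div_iff₀ (by positivity) hlog]
  push_cast at hle ⊢
  calc _ ≤ ((4 * h + 1) * (5 * h + 3) : ℝ) * (2 * (N + 2) + 6) := by gcongr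
    _ ≤ 60 * h ^ 2 * (2 * (N + 2) + 6) := by gcongr ?_ * _; nlinarith
    _ < 120 * h ^ 2 * (N + 2 + 7) := by nlinarith [sq_nonneg (h : ℝ)]
end

section
/- For every integer h ≥ 2 there exists k₀ = k₀(h) such that for all k ≥ k₀, s_F((L_{2k−1})^h) ≥ 2k − 3h/4 − 3. -/
open Real in
/-- Binet's formula for the Lucas numbers. -/
theorem coe_lucas_eq (n : ℕ) : (lucas n : ℝ) = goldenRatio ^ n + goldenConj ^ n := by
  induction n using Nat.twoStepInduction with
  | zero => norm_num [lucas]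
  | one => simp [lucas, goldenRatio_add_goldenConj]
  | more n ih₀ ih₁ =>
    have hrec : lucas (n + 2) = lucas n + lucas (n + 1) := by
      cases n with
      | zero => rfl
      | succ n =>
        have e₁ : Nat.fib (n + 2) = Nat.fib n + Nat.fib (n + 1) := Nat.fib_add_two
        have e₂ : Nat.fib (n + 4) = Nat.fib (n + 2) + Nat.fib (n + 3) := Nat.fib_add_two
        change Nat.fib (n + 2) + Nat.fib (n + 4) =
          (Nat.fib n + Nat.fib (n + 2)) + (Nat.fib (n + 1) + Nat.fib (n + 3))
        omega
    rw [hrec]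
    push_cast
    rw [ih₀, ih₁, pow_add _ n 2, pow_add _ n 2, goldenRatio_sq, goldenConj_sq]
    ring

open Real in
theorem goldenRatio_pow_le_fib (n : ℕ) : goldenRatio ^ n ≤ Nat.fib (n + 2) := by
  induction n using Nat.twoStepInduction with
  | zero => simp
  | one =>
    have := goldenRatio_lt_two.le
    simpa [Nat.fib_add_two] using this
  | more n ih₀ ih₁ =>
    rw [pow_add, goldenRatio_sq, Nat.fib_add_two (n := n + 2)]
    push_cast
    rw [pow_succ] at ih₁
    linarith

theorem mul_fib_le_fib_add (n c : ℕ) : c * Nat.fib n ≤ Nat.fib (n + c) := by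
  induction c with
  | zero => simp
  | succ c ih =>
    cases c with
    | zero => simpa using Nat.fib_le_fib_succ
    | succ c =>
      have e : Nat.fib (n + (c + 1 + 1)) = Nat.fib (n + c) + Nat.fib (n + (c + 1)) :=
        Nat.fib_add_two
      have : Nat.fib n ≤ Nat.fib (n + c) := Nat.fib_mono (Nat.le_add_right n c)
      rw [e, add_mul, one_mul]
      omega

theorem sF_fib_succ_add {n r : ℕ} (hr : r < Nat.fib n) :
    sF (Nat.fib (n + 1) + r) = sF r + 1 := by
  have e : Nat.fib (n + 2) = Nat.fib n + Nat.fib (n + 1) := Nat.fib_add_two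
  have hg : Nat.greatestFib (Nat.fib (n + 1) + r) = n + 1 := by
    apply le_antisymm
    · rw [← Nat.lt_succ_iff, Nat.greatestFib_lt]
      change _ < Nat.fib (n + 2)
      omega
    · rw [Nat.le_greatestFib]
      omega
  have hpos : 0 < Nat.fib (n + 1) := Nat.fib_pos.2 n.succ_pos
  rw [sF, Nat.zeckendorf_of_pos (by omega), hg, Nat.add_sub_cancel_left, List.length_cons, sF]

theorem le_sF_fib_sub {X b : ℕ} (hX : 0 < X) (hb : X ≤ Nat.fib b) (d : ℕ) :
    d ≤ sF (Nat.fib (b + 2 * d) - X) := by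
  induction d with
  | zero => simp
  | succ d ih =>
    have e : Nat.fib (b + 2 * (d + 1)) = Nat.fib (b + 2 * d) + Nat.fib (b + 2 * d + 1) :=
      Nat.fib_add_two
    have hle : Nat.fib b ≤ Nat.fib (b + 2 * d) := Nat.fib_mono (by omega)
    have e' : Nat.fib (b + 2 * (d + 1)) - X =
        Nat.fib (b + 2 * d + 1) + (Nat.fib (b + 2 * d) - X) := by omega
    rw [e', sF_fib_succ_add (by omega)]
    omega

theorem pow_add_pow_lt_add_pow {a b : ℝ} (ha : 0 < a) (hb : 0 < b) (g : ℕ) :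
    a ^ (g + 2) + b ^ (g + 2) < (a + b) ^ (g + 2) := by
  induction g with
  | zero =>
    have := mul_pos ha hb
    norm_num only
    linarith [add_sq a b]
  | succ g ih =>
    have h₁ := mul_lt_mul_of_pos_right ih (add_pos ha hb)
    have h₂ := mul_pos (pow_pos ha (g + 2)) hb
    have h₃ := mul_pos (pow_pos hb (g + 2)) ha
    rw [pow_succ a, pow_succ b, pow_succ (a + b)]
    linarith

open Real in
/-- For odd `m` and `h ≥ 2`, the power `L_m ^ h` is slightly smaller than `L_{mh}`. -/
theorem lucas_odd_pow_bounds {m : ℕ} (hm : Odd m) (g : ℕ) :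
    lucas m ^ (g + 2) < lucas (m * (g + 2)) ∧
      lucas (m * (g + 2)) ≤ lucas m ^ (g + 2) + Nat.fib (m * g + g + 5) := by
  obtain ⟨x, hx⟩ : ∃ x : ℝ, x = goldenRatio ^ m := ⟨_, rfl⟩
  obtain ⟨y, hy⟩ : ∃ y : ℝ, y = -goldenConj ^ m := ⟨_, rfl⟩
  have hxy : x * y = 1 := by
    rw [hx, hy, mul_neg, ← mul_pow, goldenRatio_mul_goldenConj, hm.neg_one_pow, neg_neg]
  have hx1 : 1 < x := hx ▸ one_lt_pow₀ one_lt_goldenRatio hm.pos.ne'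
  have hx0 : 0 < x := by linarith
  have hy0 : 0 < y := pos_of_mul_pos_right (hxy ▸ one_pos) hx0.le
  have hy1 : y < 1 := by nlinarith
  have hL : (lucas m : ℝ) = x - y := by rw [coe_lucas_eq, hx, hy]; ring
  have hLh : (lucas (m * (g + 2)) : ℝ) = x ^ (g + 2) + (-y) ^ (g + 2) := by
    rw [coe_lucas_eq, pow_mul, pow_mul, hx, hy, neg_neg]
  have habs : |(-y) ^ (g + 2)| = y ^ (g + 2) := by
    rw [abs_pow, abs_neg, abs_of_pos hy0]
  obtain ⟨hlo, hup⟩ := abs_le.1 habs.le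
  constructor
  · have key := pow_add_pow_lt_add_pow (a := x - y) (b := y) (by linarith) hy0 g
    rw [sub_add_cancel] at key
    have : ((lucas m ^ (g + 2) : ℕ) : ℝ) < lucas (m * (g + 2)) := by
      push_cast
      rw [hLh, hL]
      linarith
    exact_mod_cast this
  · have hbern := one_add_mul_le_pow (a := -y ^ 2) (by nlinarith) (g + 2)
    have hmul := mul_le_mul_of_nonneg_left hbern (pow_pos hx0 (g + 2)).le
    have hxy2 : x ^ 2 * y ^ 2 = 1 := by rw [← mul_pow, hxy, one_pow]
    have e₁ : x ^ (g + 2) * (1 + -y ^ 2) ^ (g + 2) = (x - y) ^ (g + 2) := by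
      rw [← mul_pow]
      congr 1
      linear_combination (-y) * hxy
    have e₂ : x ^ (g + 2) * (1 + ((g + 2 : ℕ) : ℝ) * -y ^ 2) =
        x ^ (g + 2) - (g + 2) * x ^ g := by
      push_cast
      linear_combination (-(g + 2 : ℝ) * x ^ g) * hxy2
    rw [e₁, e₂] at hmul
    have hyp : y ^ (g + 2) ≤ 1 := pow_le_one₀ hy0.le hy1.le
    have hxp : 1 ≤ x ^ g := one_le_pow₀ hx1.le
    have hxf : x ^ g ≤ Nat.fib (m * g + 2) := by
      rw [hx, ← pow_mul]
      exact goldenRatio_pow_le_fib _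
    have hfib : (((g + 3) * Nat.fib (m * g + 2) : ℕ) : ℝ) ≤ Nat.fib (m * g + g + 5) := by
      have := mul_fib_le_fib_add (m * g + 2) (g + 3)
      rw [show m * g + 2 + (g + 3) = m * g + g + 5 by ring] at this
      exact_mod_cast this
    push_cast at hfib
    have hgf := mul_le_mul_of_nonneg_left hxf (by positivity : (0 : ℝ) ≤ g + 3)
    have : (lucas (m * (g + 2)) : ℝ) ≤
        ((lucas m ^ (g + 2) + Nat.fib (m * g + g + 5) : ℕ) : ℝ) := by
      push_cast
      rw [hLh, hL]
      linarith
    exact_mod_cast this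

theorem stmt_13 (h : ℕ) (hh : 2 ≤ h) :
    ∃ k₀ : ℕ, ∀ k : ℕ, k₀ ≤ k →
      (sF ((lucas (2 * k - 1)) ^ h) : ℝ) ≥ 2 * k - 3 * h / 4 - 3 := by
  obtain ⟨g, rfl⟩ := Nat.exists_eq_add_of_le' hh
  refine ⟨g + 10, fun k hk => ?_⟩
  obtain ⟨m, hm⟩ : ∃ m, m = 2 * k - 1 := ⟨_, rfl⟩
  rw [← hm]
  obtain ⟨hlt, hle⟩ := lucas_odd_pow_bounds (m := m) ⟨k - 1, by omega⟩ g
  obtain ⟨d, hd⟩ : ∃ d, d = (2 * m - g - 6) / 2 := ⟨_, rfl⟩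
  obtain ⟨b, hb⟩ : ∃ b, b = m * g + 2 * m - 1 - 2 * d := ⟨_, rfl⟩
  have hbd : m * (g + 2) = b + 2 * d + 1 := by
    rw [mul_add]
    omega
  rw [hbd] at hlt hle
  have hfb : Nat.fib (m * g + g + 5) ≤ Nat.fib b := Nat.fib_mono (by omega)
  have hfd : Nat.fib b ≤ Nat.fib (b + 2 * d) := Nat.fib_mono (by omega)
  have hL : lucas (b + 2 * d + 1) = Nat.fib (b + 2 * d) + Nat.fib (b + 2 * d + 2) := rfl
  obtain ⟨X, hX⟩ : ∃ X, X = lucas (b + 2 * d + 1) - lucas m ^ (g + 2) := ⟨_, rfl⟩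
  have hmono : Nat.fib (b + 2 * d) ≤ Nat.fib (b + 2 * d + 1) := Nat.fib_le_fib_succ
  have hsF := le_sF_fib_sub (X := X) (b := b) (by omega) (by omega) d
  have hN : lucas m ^ (g + 2) =
      Nat.fib (b + 2 * d + 1 + 1) + (Nat.fib (b + 2 * d) - X) := by
    change _ = Nat.fib (b + 2 * d + 2) + _
    omega
  rw [hN, sF_fib_succ_add (by omega)]
  have hcount : 4 * k ≤ 2 * sF (Nat.fib (b + 2 * d) - X) + g + 9 := by omega
  have hcount' : (4 * k : ℝ) ≤ 2 * sF (Nat.fib (b + 2 * d) - X) + g + 9 := by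
    exact_mod_cast hcount
  have hg : (0 : ℝ) ≤ g := g.cast_nonneg
  push_cast
  linarith
end
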